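/- arXiv:1012.4915 — 3 statements merged into one kernel-verified Lean document; each statement's English description precedes it below -/
import Mathlib

section
/- There exists a positive constant C > 0 such that for all u ∈ 𝒮(ℝ_t) and all parameters (x₁,x₂,ξ₁,ξ₂) ∈ ℝ^{4n}, one has ‖(1 + ⟨x₁⟩^{2σ/(2σ+1)} + ⟨x₂ − t x₁⟩^{2σ}) u‖_{L²(ℝ_t)} ≤ C (‖P̃u‖_{L²(ℝ_t)} + ‖u‖_{L²(ℝ_t)}). -/
open MeasureTheory
open scoped ENNReal Real

noncomputable section

/-- `ℝ^n` with the Euclidean norm. -/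
abbrev E (n : ℕ) : Type := EuclideanSpace ℝ (Fin n)

variable {n : ℕ}

/-- the symbol `F(x) = |x|^{2σ} w(x) + |x|² (1 - w(x))` -/
def Fsym (σ : ℝ) (w : E n → ℝ) (x : E n) : ℝ :=
  ‖x‖ ^ (2 * σ) * w x + ‖x‖ ^ 2 * (1 - w x)

/-- the one-dimensional first-order differential operator
`P̃ = iD_t + a(t,ξ₂,ξ₁+tξ₂) F(x₂ - t x₁)`, `D_t = (2πi)^{-1} d/dt`,
depending on the parameters `(x₁,x₂,ξ₁,ξ₂)` -/
def Ptilde (σ : ℝ) (w : E n → ℝ) (a : ℝ × E n × E n → ℝ)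
    (x₁ x₂ ξ₁ ξ₂ : E n) (u : ℝ → ℂ) (t : ℝ) : ℂ :=
  Complex.I * ((2 * (π : ℂ) * Complex.I)⁻¹ * deriv u t)
    + ((a (t, ξ₂, ξ₁ + t • ξ₂) * Fsym σ w (x₂ - t • x₁) : ℝ) : ℂ) * u t


theorem aux_int (p q Φ Φ' : ℝ → ℝ) (hp : Continuous p) (hq : Continuous q)
    (hp0 : ∀ t, 0 ≤ p t) (hq0 : ∀ t, 0 ≤ q t) (hΦ0 : ∀ t, 0 ≤ Φ t)
    (hd : ∀ t, HasDerivAt Φ (Φ' t) t) (hle : ∀ t, Φ' t + p t ≤ q t)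
    (hlim : Filter.Tendsto Φ Filter.atBot (nhds 0)) :
    ∫⁻ t, ENNReal.ofReal (p t) ≤ ∫⁻ t, ENNReal.ofReal (q t) := by
  have key : ∀ R : ℝ, 0 ≤ R → ∫⁻ t in Set.Ioc (-R) R, ENNReal.ofReal (p t) ≤
      (∫⁻ t, ENNReal.ofReal (q t)) + ENNReal.ofReal (Φ (-R)) := by
    intro R hR
    have hRR : -R ≤ R := by linarith
    have h1 : Φ R - Φ (-R) ≤ ∫ t in (-R)..R, (q t - p t) := by
      apply intervalIntegral.sub_le_integral_of_hasDeriv_right_of_le hRR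
        (fun t _ => (hd t).continuousAt.continuousWithinAt)
        (fun t _ => (hd t).hasDerivWithinAt)
      · exact (hq.sub hp).integrableOn_Icc
      · intro t _
        have := hle t
        linarith
    rw [intervalIntegral.integral_sub (hq.intervalIntegrable _ _) (hp.intervalIntegrable _ _)] at h1
    have h2 : ∫ t in (-R)..R, p t ≤ (∫ t in (-R)..R, q t) + Φ (-R) := by
      have := hΦ0 R
      linarith
    rw [intervalIntegral.integral_of_le hRR, intervalIntegral.integral_of_le hRR] at h2
    have e1 := ofReal_integral_eq_lintegral_ofReal (μ := volume.restrict (Set.Ioc (-R) R))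
      (f := p) ((hp.integrableOn_Icc (a := -R) (b := R)).mono_set Set.Ioc_subset_Icc_self)
      (Filter.Eventually.of_forall hp0)
    have e2 := ofReal_integral_eq_lintegral_ofReal (μ := volume.restrict (Set.Ioc (-R) R))
      (f := q) ((hq.integrableOn_Icc (a := -R) (b := R)).mono_set Set.Ioc_subset_Icc_self)
      (Filter.Eventually.of_forall hq0)
    rw [← e1]
    refine (ENNReal.ofReal_le_ofReal h2).trans ?_
    refine ENNReal.ofReal_add_le.trans ?_
    rw [e2]
    exact add_le_add_left (setLIntegral_le_lintegral _ _) _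
  have cov : AECover volume Filter.atTop (fun R : ℝ => Set.Ioc (-R) R) :=
    aecover_Ioc Filter.tendsto_neg_atTop_atBot Filter.tendsto_id
  have t1 := cov.lintegral_tendsto_of_countably_generated
    (f := fun t => ENNReal.ofReal (p t)) (by fun_prop)
  have t2 : Filter.Tendsto (fun R : ℝ => (∫⁻ t, ENNReal.ofReal (q t)) + ENNReal.ofReal (Φ (-R)))
      Filter.atTop (nhds ((∫⁻ t, ENNReal.ofReal (q t)) + ENNReal.ofReal 0)) := by
    refine Filter.Tendsto.const_add _ ?_
    exact ENNReal.tendsto_ofReal (hlim.comp Filter.tendsto_neg_atTop_atBot)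
  simp only [ENNReal.ofReal_zero, add_zero] at t2
  refine le_of_tendsto_of_tendsto t1 t2 ?_
  filter_upwards [Filter.eventually_ge_atTop 0] with R hR using key R hR

theorem aux_eLp (p : ℝ → ℂ) :
    eLpNorm p 2 volume ^ 2 = ∫⁻ t, ENNReal.ofReal (‖p t‖ ^ 2) := by
  have := eLpNorm_nnreal_pow_eq_lintegral (f := p) (μ := volume) (p := 2) (by norm_num)
  simp at this
  rw [this]
  congr 1
  ext t
  rw [← ofReal_norm, ENNReal.ofReal_pow (norm_nonneg _)]

theorem aux_arctan (r : ℝ) : 1 / 4 ≤ 2 - Real.arctan r ∧ 2 - Real.arctan r ≤ 4 := by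
  have h1 := Real.arctan_lt_pi_div_two r
  have h2 := Real.neg_pi_div_two_lt_arctan r
  have h3 := Real.pi_lt_d2
  constructor <;> linarith

theorem aux_F {n : ℕ} (σ : ℝ) (hσ0 : 0 < σ) (hσ1 : σ < 1)
    (w : E n → ℝ) (hw01 : ∀ x, 0 ≤ w x ∧ w x ≤ 1) (y : E n) :
    0 ≤ Fsym σ w y ∧ (1 ≤ ‖y‖ → (‖y‖ ^ 2) ^ σ ≤ Fsym σ w y) ∧ (‖y‖ ^ 2) ^ σ - 1 ≤ Fsym σ w y := by
  have e : (‖y‖ ^ 2) ^ σ = ‖y‖ ^ (2 * σ) := by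
    rw [← Real.rpow_natCast_mul (norm_nonneg _)]; norm_num
  have h0 : 0 ≤ Fsym σ w y := by
    have := hw01 y
    have : 0 ≤ 1 - w y := by linarith
    unfold Fsym
    have := (hw01 y).1
    positivity
  have h1 : 1 ≤ ‖y‖ → (‖y‖ ^ 2) ^ σ ≤ Fsym σ w y := by
    intro hy
    have h2 : (‖y‖ ^ 2) ^ σ ≤ ‖y‖ ^ 2 := by
      apply Real.rpow_le_self_of_one_le _ hσ1.le
      nlinarith
    unfold Fsym
    rw [← e]
    have := hw01 y
    nlinarith
  refine ⟨h0, h1, ?_⟩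
  by_cases hy : 1 ≤ ‖y‖
  · linarith [h1 hy]
  · have : (‖y‖ ^ 2) ^ σ ≤ 1 := by
      apply Real.rpow_le_one (by positivity) _ hσ0.le
      have := norm_nonneg y
      nlinarith
    linarith

theorem aux_alg (a₀ c₁ K L G : ℝ) (ha : 0 < a₀) 
    (hK : K * c₁ = (2 * a₀ + 1) ^ 2 / a₀) :
    a₀ / 2 * G ^ 2 - 2 * (K * c₁) ≤
      a₀ * (G - 2 * L) * G - L * G + K * c₁ * (L * (L - 2)) := by
  have hKp : 0 < K * c₁ := by rw [hK]; positivity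
  have h1 : K * c₁ * (L ^ 2 / 2 - 2) ≤ K * c₁ * (L * (L - 2)) := by
    apply mul_le_mul_of_nonneg_left _ hKp.le
    nlinarith [sq_nonneg (L - 2)]
  have h2 : 0 ≤ a₀ / 2 * G ^ 2 - (2 * a₀ + 1) * L * G + (2 * a₀ + 1) ^ 2 / a₀ * (L ^ 2 / 2) := by
    have : a₀ / 2 * G ^ 2 - (2 * a₀ + 1) * L * G + (2 * a₀ + 1) ^ 2 / a₀ * (L ^ 2 / 2)
      = (a₀ * G - (2 * a₀ + 1) * L) ^ 2 / (2 * a₀) := by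
      field_simp
      ring
    rw [this]
    positivity
  rw [← hK] at h2
  nlinarith

set_option maxHeartbeats 2000000 in
theorem aux_mult {n : ℕ} (σ : ℝ) (hσ0 : 0 < σ) (hσ1 : σ < 1)
    (w : E n → ℝ) (hw01 : ∀ x, 0 ≤ w x ∧ w x ≤ 1) (a₀ : ℝ) (ha₀ : 0 < a₀) :
    ∃ B C : ℝ, 0 < B ∧ 0 < C ∧ ∀ x₁ x₂ : E n, ∃ G M M' : ℝ → ℝ, Continuous G ∧
      (∀ t, HasDerivAt M (M' t) t) ∧
      (∀ t, 1 + (1 + ‖x₁‖ ^ 2) ^ (σ / (2 * σ + 1)) + (1 + ‖x₂ - t • x₁‖ ^ 2) ^ σ ≤ 3 * G t) ∧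
      (∀ t, 0 ≤ M t ∧ M t ≤ B * G t) ∧
      (∃ D, ∀ t, G t ≤ D * (1 + t ^ 2)) ∧
      (∀ t V, a₀ * Fsym σ w (x₂ - t • x₁) ≤ V →
        a₀ / 2 * G t ^ 2 - C ≤ V * M t - M' t / (4 * π)) := by
  set c₁ : ℝ := min (1 / 80) (a₀ / 4) with hc₁
  have hc₁0 : 0 < c₁ := by positivity
  set K : ℝ := (2 * a₀ + 1) ^ 2 / a₀ / c₁ with hK
  have hKc : K * c₁ = (2 * a₀ + 1) ^ 2 / a₀ := by rw [hK]; field_simp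
  have hK0 : 0 < K := by positivity
  refine ⟨4 * K + 1, 2 * (K * c₁), by positivity, by positivity, ?_⟩
  intro x₁ x₂
  set S : ℝ := (1 + ‖x₁‖ ^ 2) ^ (1 / (2 * σ + 1)) with hS
  set L : ℝ := (1 + ‖x₁‖ ^ 2) ^ (σ / (2 * σ + 1)) with hL
  have hb1 : (1 : ℝ) ≤ 1 + ‖x₁‖ ^ 2 := by nlinarith [sq_nonneg ‖x₁‖]
  have hb0 : (0 : ℝ) ≤ 1 + ‖x₁‖ ^ 2 := by linarith
  have hS1 : 1 ≤ S := Real.one_le_rpow hb1 (by positivity)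
  have hL1 : 1 ≤ L := Real.one_le_rpow hb1 (by positivity)
  have hSL : S ^ σ = L := by
    rw [hS, hL, ← Real.rpow_mul hb0]
    congr 1
    field_simp
  have hSLX : S * L ^ 2 = 1 + ‖x₁‖ ^ 2 := by
    rw [hS, hL, ← Real.rpow_mul_natCast hb0, ← Real.rpow_add (by linarith)]
    have : 1 / (2 * σ + 1) + σ / (2 * σ + 1) * ((2 : ℕ) : ℝ) = 1 := by
      push_cast
      field_simp
      ring
    rw [this, Real.rpow_one]
  set t₀ : ℝ := inner ℝ x₂ x₁ / ‖x₁‖ ^ 2 with ht₀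
  have hy : ∀ t : ℝ, (t - t₀) ^ 2 * ‖x₁‖ ^ 2 ≤ ‖x₂ - t • x₁‖ ^ 2 := by
    intro t
    have e : ‖x₂ - t • x₁‖ ^ 2 = ‖(x₂ - t₀ • x₁) - (t - t₀) • x₁‖ ^ 2 := by
      congr 2
      module
    by_cases h : x₁ = 0
    · simp [h]
    · have hn : ‖x₁‖ ≠ 0 := by simpa using h
      have orth : inner ℝ (x₂ - t₀ • x₁) ((t - t₀) • x₁) = 0 := by
        rw [inner_smul_right, inner_sub_left, real_inner_smul_left, real_inner_self_eq_norm_sq, ht₀]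
        field_simp
        ring
      rw [e, norm_sub_sq_real, orth, norm_smul, mul_pow, Real.norm_eq_abs, sq_abs]
      nlinarith [sq_nonneg ‖x₂ - t₀ • x₁‖]
  set Q : ℝ → ℝ := fun t => S + ‖x₂ - t • x₁‖ ^ 2 with hQ
  have hQS : ∀ t, S ≤ Q t := fun t => by simp only [hQ]; nlinarith [sq_nonneg ‖x₂ - t • x₁‖]
  have hQ0 : ∀ t, 0 < Q t := fun t => by linarith [hQS t]
  have hQd : ∀ t, HasDerivAt Q (2 * inner ℝ (x₂ - t • x₁) (-x₁)) t := by
    intro t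
    have h1 : HasDerivAt (fun t : ℝ => x₂ - t • x₁) (-x₁) t := by
      simpa using ((hasDerivAt_id t).smul_const x₁).const_sub x₂
    exact h1.norm_sq.const_add S
  have hGd : ∀ t, HasDerivAt (fun t => Q t ^ σ)
      ((2 * inner ℝ (x₂ - t • x₁) (-x₁)) * σ * Q t ^ (σ - 1)) t := by
    intro t
    exact (hQd t).rpow_const (Or.inl (hQ0 t).ne')
  have hLG : ∀ t, L ≤ Q t ^ σ := by
    intro t
    rw [← hSL]
    exact Real.rpow_le_rpow (by linarith) (hQS t) hσ0.le
  have hGd' : ∀ t, (2 * inner ℝ (x₂ - t • x₁) (-x₁)) * σ * Q t ^ (σ - 1) ≤ 2 * L * Q t ^ σ := by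
    intro t
    have h1 : inner ℝ (x₂ - t • x₁) (-x₁) ≤ ‖x₂ - t • x₁‖ * ‖x₁‖ := by
      simpa using real_inner_le_norm (x₂ - t • x₁) (-x₁)
    have h2 : ‖x₂ - t • x₁‖ * ‖x₁‖ ≤ L * Q t := by
      apply abs_le_of_sq_le_sq' _ (by have := hQ0 t; positivity) |>.2
      rw [mul_pow, mul_pow]
      have h3 : ‖x₂ - t • x₁‖ ^ 2 ≤ Q t := by simp only [hQ]; linarith
      have h4 : ‖x₁‖ ^ 2 ≤ L ^ 2 * Q t := by
        have : S * L ^ 2 ≤ Q t * L ^ 2 := by gcongr; exact hQS t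
        linarith
      calc _ ≤ Q t * (L ^ 2 * Q t) := by gcongr
        _ = _ := by ring
    have h5 : Q t ^ σ = Q t * Q t ^ (σ - 1) := by
      rw [Real.rpow_sub_one (hQ0 t).ne']
      have := (hQ0 t).ne'
      field_simp
    have h6 : 0 ≤ Q t ^ (σ - 1) := Real.rpow_nonneg (hQ0 t).le _
    have h7 : inner ℝ (x₂ - t • x₁) (-x₁) * σ ≤ L * Q t := by
      have : 0 ≤ L * Q t := by have := hQ0 t; positivity
      calc _ ≤ (L * Q t) * σ := by gcongr; linarith
        _ ≤ _ := by nlinarith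
    rw [h5]
    nlinarith [mul_le_mul_of_nonneg_right h7 h6]
  set g : ℝ → ℝ := fun t => 2 - Real.arctan ((t - t₀) * L) with hg
  have hgd : ∀ t, HasDerivAt g (-(1 / (1 + ((t - t₀) * L) ^ 2) * L)) t := by
    intro t
    have h1 : HasDerivAt (fun t => (t - t₀) * L) L t := by
      simpa using ((hasDerivAt_id t).sub_const t₀).mul_const L
    exact h1.arctan.const_sub 2
  refine ⟨fun t => Q t ^ σ, fun t => K * L * g t + Q t ^ σ,
    fun t => K * L * (-(1 / (1 + ((t - t₀) * L) ^ 2) * L)) +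
      (2 * inner ℝ (x₂ - t • x₁) (-x₁)) * σ * Q t ^ (σ - 1), ?_, ?_, ?_, ?_, ?_, ?_⟩
  · exact continuous_iff_continuousAt.2 fun t => (hGd t).continuousAt
  · intro t
    exact ((hgd t).const_mul (K * L)).add (hGd t)
  · intro t
    have h1 : (1 + ‖x₂ - t • x₁‖ ^ 2) ^ σ ≤ Q t ^ σ := by
      apply Real.rpow_le_rpow (by positivity) _ hσ0.le
      simp only [hQ]; linarith
    have := hLG t
    simp only
    linarith
  · intro t
    have h1 := aux_arctan ((t - t₀) * L)
    have h2 := hLG t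
    have h3 : 0 ≤ g t := by simp only [hg]; linarith [h1.1]
    have h4 : g t ≤ 4 := by simp only [hg]; linarith [h1.2]
    have h5 : 0 ≤ Q t ^ σ := by linarith
    constructor
    · positivity
    · have : K * L * g t ≤ K * Q t ^ σ * 4 := by gcongr
      simp only
      linarith
  · refine ⟨S + 2 * ‖x₂‖ ^ 2 + 2 * ‖x₁‖ ^ 2, fun t => ?_⟩
    have h1 : Q t ^ σ ≤ Q t := Real.rpow_le_self_of_one_le (by linarith [hQS t]) hσ1.le
    have h2 : ‖x₂ - t • x₁‖ ≤ ‖x₂‖ + |t| * ‖x₁‖ := by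
      refine (norm_sub_le _ _).trans ?_
      rw [norm_smul, Real.norm_eq_abs]
    have h3 : ‖x₂ - t • x₁‖ ^ 2 ≤ (‖x₂‖ + |t| * ‖x₁‖) ^ 2 := by gcongr
    have h4 : (‖x₂‖ + |t| * ‖x₁‖) ^ 2 ≤ 2 * ‖x₂‖ ^ 2 + 2 * (t ^ 2 * ‖x₁‖ ^ 2) := by
      rw [← sq_abs t]
      nlinarith [sq_nonneg (‖x₂‖ - |t| * ‖x₁‖)]
    refine h1.trans ?_
    simp only [hQ]
    have p1 : 0 ≤ S * t ^ 2 := by positivity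
    have p2 : 0 ≤ ‖x₂‖ ^ 2 * t ^ 2 := by positivity
    nlinarith [sq_nonneg ‖x₁‖]
  · intro t V hV
    obtain ⟨F0, F1, F2⟩ := aux_F σ hσ0 hσ1 w hw01 (x₂ - t • x₁)
    have ar := aux_arctan ((t - t₀) * L)
    have g1 : 1 / 4 ≤ g t := ar.1
    have hV0 : 0 ≤ V := le_trans (by positivity) hV
    set s : ℝ := (t - t₀) * L with hs
    have hpi : π < 3.15 := Real.pi_lt_d2
    have hpi0 : 3 < π := Real.pi_gt_three
    have main : c₁ * (L - 2) ≤ V * g t + 1 / (1 + s ^ 2) * L / (4 * π) := by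
      have n1 : 0 ≤ V * g t := by positivity
      have n2 : 0 ≤ 1 / (1 + s ^ 2) * L / (4 * π) := by positivity
      by_cases hx : ‖x₁‖ < 1
      · have : L ≤ 2 := by
          have h1 : L ≤ 1 + ‖x₁‖ ^ 2 := by
            apply Real.rpow_le_self_of_one_le hb1
            rw [div_le_one (by positivity)]
            linarith
          nlinarith [norm_nonneg x₁]
        have := mul_nonneg hc₁0.le (sub_nonneg.2 this)
        linarith
      · push Not at hx
        by_cases hs2 : s ^ 2 ≤ 4
        · have h1 : c₁ * L ≤ 1 / (1 + s ^ 2) * L / (4 * π) := by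
            have : c₁ ≤ 1 / (1 + s ^ 2) / (4 * π) := by
              refine (min_le_left _ _).trans ?_
              rw [div_div]
              apply one_div_le_one_div_of_le (by positivity)
              nlinarith
            calc c₁ * L ≤ (1 / (1 + s ^ 2) / (4 * π)) * L := by gcongr
              _ = _ := by ring
          linarith
        · push Not at hs2
          have h1 : S ≤ ‖x₂ - t • x₁‖ ^ 2 := by
            refine le_trans ?_ (hy t)
            have h2 : S * L ^ 2 ≤ ((t - t₀) ^ 2 * ‖x₁‖ ^ 2) * L ^ 2 := by
              rw [hSLX]
              have : ((t - t₀) ^ 2 * ‖x₁‖ ^ 2) * L ^ 2 = s ^ 2 * ‖x₁‖ ^ 2 := by rw [hs]; ring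
              rw [this]
              nlinarith
            exact le_of_mul_le_mul_right h2 (by positivity)
          have h3 : 1 ≤ ‖x₂ - t • x₁‖ := by
            have := norm_nonneg (x₂ - t • x₁)
            nlinarith
          have h4 : L ≤ Fsym σ w (x₂ - t • x₁) := by
            refine le_trans ?_ (F1 h3)
            rw [← hSL]
            exact Real.rpow_le_rpow (by linarith) h1 hσ0.le
          have h5 : c₁ * L ≤ V * g t := by
            calc c₁ * L ≤ (a₀ / 4) * L := by gcongr; exact min_le_right _ _
              _ = (a₀ * L) * (1 / 4) := by ring
              _ ≤ V * g t := by
                gcongr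
                exact le_trans (by gcongr) hV
          linarith
    have hGL : Q t ^ σ ≤ L + (‖x₂ - t • x₁‖ ^ 2) ^ σ := by
      rw [← hSL]
      exact Real.rpow_add_le_add_rpow (by linarith) (by positivity) hσ0.le hσ1.le
    have hFG : Q t ^ σ - 2 * L ≤ Fsym σ w (x₂ - t • x₁) := by linarith
    have hG0 : 0 ≤ Q t ^ σ := by linarith [hLG t]
    have hVG : a₀ * (Q t ^ σ - 2 * L) * Q t ^ σ ≤ V * Q t ^ σ := by
      gcongr
      exact le_trans (by gcongr) hV
    have hM2 : (2 * inner ℝ (x₂ - t • x₁) (-x₁)) * σ * Q t ^ (σ - 1) / (4 * π) ≤ L * Q t ^ σ := by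
      rw [div_le_iff₀ (by positivity)]
      refine (hGd' t).trans ?_
      have : 0 ≤ L * Q t ^ σ := by positivity
      nlinarith
    have hmain := mul_le_mul_of_nonneg_left main (show 0 ≤ K * L by positivity)
    have alg := aux_alg a₀ c₁ K L (Q t ^ σ) ha₀ hKc
    simp only
    have e : V * (K * L * g t + Q t ^ σ) - (K * L * (-(1 / (1 + s ^ 2) * L)) +
        (2 * inner ℝ (x₂ - t • x₁) (-x₁)) * σ * Q t ^ (σ - 1)) / (4 * π)
      = K * L * (V * g t + 1 / (1 + s ^ 2) * L / (4 * π)) + V * Q t ^ σ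
        - (2 * inner ℝ (x₂ - t • x₁) (-x₁)) * σ * Q t ^ (σ - 1) / (4 * π) := by ring
    rw [e]
    linarith

theorem aux_pt (a₀ B C G M M' V m : ℝ) (u u' f : ℂ) (ha : 0 < a₀)
    (hM : 0 ≤ M) (hMB : M ≤ B * G) (hB : 0 < B)
    (hm : m = M' * ‖u‖ ^ 2 + M * (2 * inner ℝ u u'))
    (hu : u' = (2 * π) • f - (2 * π * V) • u)
    (hk : a₀ / 2 * G ^ 2 - C ≤ V * M - M' / (4 * π)) (hC : 0 < C) :
    9 / (π * a₀) * m + 9 * G ^ 2 * ‖u‖ ^ 2 ≤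
      36 / a₀ * (C + B ^ 2 / a₀) * (‖u‖ ^ 2 + ‖f‖ ^ 2) := by
  have hpi := Real.pi_pos
  have h1 : inner ℝ u u' = 2 * π * inner ℝ u f - 2 * π * V * ‖u‖ ^ 2 := by
    rw [hu, inner_sub_right, real_inner_smul_right, real_inner_smul_right,
      real_inner_self_eq_norm_sq]
  have h2 : inner ℝ u f ≤ ‖u‖ * ‖f‖ := real_inner_le_norm u f
  have h3 : M * inner ℝ u f ≤ B * G * (‖u‖ * ‖f‖) :=
    calc _ ≤ M * (‖u‖ * ‖f‖) := by gcongr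
      _ ≤ _ := by gcongr
  have h4 : B * G * (‖u‖ * ‖f‖) ≤ a₀ / 4 * (G ^ 2 * ‖u‖ ^ 2) + B ^ 2 / a₀ * ‖f‖ ^ 2 := by
    have : a₀ / 4 * (G ^ 2 * ‖u‖ ^ 2) + B ^ 2 / a₀ * ‖f‖ ^ 2 - B * G * (‖u‖ * ‖f‖)
        = (a₀ * (G * ‖u‖) - 2 * B * ‖f‖) ^ 2 / (4 * a₀) := by
      field_simp
      ring
    have h5 : 0 ≤ (a₀ * (G * ‖u‖) - 2 * B * ‖f‖) ^ 2 / (4 * a₀) := by positivity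
    linarith
  have h6 := mul_le_mul_of_nonneg_right hk (sq_nonneg ‖u‖)
  have h7 : m = 4 * π * (M * inner ℝ u f - (V * M - M' / (4 * π)) * ‖u‖ ^ 2) := by
    rw [hm, h1]
    field_simp
    ring
  have h8 : M * inner ℝ u f - (V * M - M' / (4 * π)) * ‖u‖ ^ 2 ≤
      C * ‖u‖ ^ 2 + B ^ 2 / a₀ * ‖f‖ ^ 2 - a₀ / 4 * (G ^ 2 * ‖u‖ ^ 2) := by linarith
  have h9 : 9 / (π * a₀) * m = 36 / a₀ * (M * inner ℝ u f - (V * M - M' / (4 * π)) * ‖u‖ ^ 2) := by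
    rw [h7]
    field_simp
    ring
  rw [h9]
  have h10 := mul_le_mul_of_nonneg_left h8 (show 0 ≤ 36 / a₀ by positivity)
  have h11 : 36 / a₀ * (C * ‖u‖ ^ 2 + B ^ 2 / a₀ * ‖f‖ ^ 2 - a₀ / 4 * (G ^ 2 * ‖u‖ ^ 2))
    = 36 / a₀ * (C * ‖u‖ ^ 2 + B ^ 2 / a₀ * ‖f‖ ^ 2) - 9 * G ^ 2 * ‖u‖ ^ 2 := by
    field_simp
    ring
  have h12 : 36 / a₀ * (C * ‖u‖ ^ 2 + B ^ 2 / a₀ * ‖f‖ ^ 2) ≤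
      36 / a₀ * ((C + B ^ 2 / a₀) * (‖u‖ ^ 2 + ‖f‖ ^ 2)) := by
    have : 0 ≤ C * ‖f‖ ^ 2 := by positivity
    have : 0 ≤ B ^ 2 / a₀ * ‖u‖ ^ 2 := by positivity
    gcongr
    linarith
  linarith

theorem aux_lim (u : SchwartzMap ℝ ℂ) (M : ℝ → ℝ) (D : ℝ) (hM0 : ∀ t, 0 ≤ M t)
    (hM : ∀ t, M t ≤ D * (1 + t ^ 2)) :
    Filter.Tendsto (fun t => M t * ‖u t‖ ^ 2) Filter.atBot (nhds 0) := by
  obtain ⟨C0, h0⟩ := u.decay 0 0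
  obtain ⟨C2, h2⟩ := u.decay 2 0
  have hD : 0 ≤ D := by
    have := (hM0 0).trans (hM 0)
    simpa using this
  have hz : Filter.Tendsto (fun t => D * (C0 + C2) * ‖u t‖) Filter.atBot (nhds 0) := by
    have := (u.tendsto_cocompact).mono_left (atBot_le_cocompact (α := ℝ))
    simpa using (this.norm).const_mul (D * (C0 + C2))
  refine squeeze_zero (fun t => mul_nonneg (hM0 t) (by positivity)) (fun t => ?_) hz
  have a0 := h0.2 t
  have a2 := h2.2 t
  simp at a0 a2
  calc M t * ‖u t‖ ^ 2 ≤ D * (1 + t ^ 2) * ‖u t‖ ^ 2 := by gcongr; exact hM t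
    _ = D * (‖u t‖ + t ^ 2 * ‖u t‖) * ‖u t‖ := by ring
    _ ≤ _ := by gcongr


/-- Lemma 2.1: a priori estimate for the one-dimensional
operator `P̃`, uniform in the parameters `(x₁,x₂,ξ₁,ξ₂)`. -/
theorem statement6
    (n : ℕ) (hn : 1 ≤ n) (σ : ℝ) (hσ0 : 0 < σ) (hσ1 : σ < 1)
    (w : E n → ℝ) (hw : ContDiff ℝ (⊤ : ℕ∞) w)
    (hw01 : ∀ x, 0 ≤ w x ∧ w x ≤ 1)
    (hwout : ∀ x : E n, 2 ≤ ‖x‖ → w x = 1)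
    (hwin : ∀ x : E n, ‖x‖ ≤ 1 → w x = 0)
    (a : ℝ × E n × E n → ℝ) (ha : ContDiff ℝ (⊤ : ℕ∞) a)
    (haB : ∀ k : ℕ, ∃ C : ℝ, ∀ p, ‖iteratedFDeriv ℝ k a p‖ ≤ C)
    (a₀ : ℝ) (ha₀ : 0 < a₀) (haLB : ∀ p, a₀ ≤ a p)
    :
    ∃ C : ℝ, 0 < C ∧ ∀ u : SchwartzMap ℝ ℂ, ∀ x₁ x₂ ξ₁ ξ₂ : E n,
      eLpNorm (fun t : ℝ =>
          (((1 + (1 + ‖x₁‖ ^ 2) ^ (σ / (2 * σ + 1)) + (1 + ‖x₂ - t • x₁‖ ^ 2) ^ σ) : ℝ) : ℂ)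
            * u t) 2 volume
        ≤ ENNReal.ofReal C *
          (eLpNorm (Ptilde σ w a x₁ x₂ ξ₁ ξ₂ ⇑u) 2 volume + eLpNorm (⇑u) 2 volume) := by
  obtain ⟨B, C, hB, hC, hmult⟩ := aux_mult σ hσ0 hσ1 w hw01 a₀ ha₀
  set C₄ : ℝ := 36 / a₀ * (C + B ^ 2 / a₀) with hC₄
  have hC₄0 : 0 < C₄ := by positivity
  refine ⟨Real.sqrt C₄, Real.sqrt_pos.2 hC₄0, ?_⟩
  intro u x₁ x₂ ξ₁ ξ₂
  obtain ⟨G, M, M', hGc, hMd, hW, hMB, ⟨D, hD⟩, hk⟩ := hmult x₁ x₂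
  set f : ℝ → ℂ := Ptilde σ w a x₁ x₂ ξ₁ ξ₂ ⇑u with hf
  have hud : ∀ t, HasDerivAt (⇑u) (deriv u t) t := fun t => u.differentiableAt.hasDerivAt
  have hac := ha.continuous
  have hwc := hw.continuous
  have hfc : Continuous f := by
    have h1 : Continuous (deriv (⇑u)) := (u.smooth 1).continuous_deriv le_rfl
    have h2 : Continuous (fun x : E n => ‖x‖ ^ (2 * σ)) :=
      continuous_norm.rpow_const (fun _ => Or.inr (by positivity))
    have h3 : Continuous (Fsym σ w) := by
      unfold Fsym
      fun_prop
    have h4 := u.continuous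
    rw [hf]
    unfold Ptilde
    fun_prop
  have hint := aux_int (fun t => 9 * G t ^ 2 * ‖u t‖ ^ 2)
    (fun t => C₄ * (‖u t‖ ^ 2 + ‖f t‖ ^ 2))
    (fun t => 9 / (π * a₀) * (M t * ‖u t‖ ^ 2))
    (fun t => 9 / (π * a₀) * (M' t * ‖u t‖ ^ 2 + M t * (2 * inner ℝ (u t) (deriv u t))))
    (by have := u.continuous; fun_prop) (by have := u.continuous; fun_prop)
    (fun t => by positivity) (fun t => by positivity)
    (fun t => by have := (hMB t).1; have := Real.pi_pos; positivity)
    (fun t => ((hMd t).mul (hud t).norm_sq).const_mul _)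
    (fun t => by
      refine aux_pt a₀ B C (G t) (M t) (M' t)
        (a (t, ξ₂, ξ₁ + t • ξ₂) * Fsym σ w (x₂ - t • x₁)) _ (u t) (deriv u t) (f t)
        ha₀ (hMB t).1 (hMB t).2 hB rfl ?_ (hk t _ ?_) hC
      · simp only [hf, Ptilde, Complex.real_smul]
        have : (π : ℂ) ≠ 0 := by exact_mod_cast Real.pi_ne_zero
        push_cast
        field_simp
        ring
      · have := (aux_F σ hσ0 hσ1 w hw01 (x₂ - t • x₁)).1
        gcongr
        exact haLB _)
    (by
      have := (aux_lim u M (B * D) (fun t => (hMB t).1) (fun t => by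
        refine (hMB t).2.trans ?_
        rw [mul_assoc]
        gcongr
        exact hD t)).const_mul (9 / (π * a₀))
      simpa using this)
  refine (ENNReal.pow_le_pow_left_iff (n := 2) (by norm_num)).1 ?_
  rw [aux_eLp]
  calc _ ≤ ∫⁻ t, ENNReal.ofReal (9 * G t ^ 2 * ‖u t‖ ^ 2) := by
        refine lintegral_mono fun t => ENNReal.ofReal_le_ofReal ?_
        rw [norm_mul, mul_pow, Complex.norm_real, Real.norm_eq_abs, sq_abs]
        have h1 := hW t
        have h2 : 9 * G t ^ 2 = (3 * G t) ^ 2 := by ring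
        rw [h2]
        gcongr
    _ ≤ _ := hint
    _ = ENNReal.ofReal C₄ * (eLpNorm f 2 volume ^ 2 + eLpNorm (⇑u) 2 volume ^ 2) := by
        rw [aux_eLp, aux_eLp, ← lintegral_add_left (by fun_prop), ← lintegral_const_mul _
          (by have := u.continuous; fun_prop)]
        congr 1
        ext t
        rw [ENNReal.ofReal_mul hC₄0.le, add_comm, ENNReal.ofReal_add (by positivity) (by positivity)]
    _ ≤ _ := by
        rw [mul_pow, ← ENNReal.ofReal_pow (Real.sqrt_nonneg _), Real.sq_sqrt hC₄0.le]
        gcongr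
        rw [add_sq]
        refine add_le_add_left ?_ _
        exact le_self_add
end
end

section
/- There exists a constant C₁ > 0 such that for all u ∈ 𝒮(ℝ_t) and all parameters (x₁,x₂,ξ₁,ξ₂) ∈ ℝ^{4n}, one has ‖u‖²_{L^∞(ℝ_t)} ≤ C₁ ‖P̃u‖_{L²(ℝ_t)} ‖u‖_{L²(ℝ_t)}. -/
open MeasureTheory
open scoped ENNReal Real

noncomputable section

variable {n : ℕ}

theorem aux_ineq (u g : ℝ → ℂ) (G : ℝ → ℝ) (hu : Differentiable ℝ u) (hg : Continuous g)
    (hG : ∀ t, 0 ≤ G t)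
    (h : ∀ t, g t = Complex.I * ((2 * (π : ℂ) * Complex.I)⁻¹ * deriv u t) + (G t : ℂ) * u t)
    (hlim : Filter.Tendsto u Filter.atBot (nhds 0)) :
    eLpNorm u ⊤ volume ^ 2
      ≤ ENNReal.ofReal (4 * π) * eLpNorm g 2 volume * eLpNorm u 2 volume := by
  have hder : ∀ t, deriv u t = (2 * π : ℝ) • (g t - (G t) • u t) := by
    intro t
    rw [h t]
    have := Real.pi_ne_zero
    have h2 : (π : ℂ) ≠ 0 := by exact_mod_cast this
    simp only [Complex.real_smul]
    push_cast
    field_simp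
    simp
  have hcu := hu.continuous
  have key : ∀ t, ENNReal.ofReal (‖u t‖ ^ 2) ≤ ∫⁻ s, ENNReal.ofReal (4 * π * (‖g s‖ * ‖u s‖)) := by
    intro t
    have step : ∀ s ≤ t, ENNReal.ofReal (‖u t‖ ^ 2 - ‖u s‖ ^ 2) ≤
        ∫⁻ s, ENNReal.ofReal (4 * π * (‖g s‖ * ‖u s‖)) := by
      intro s hs
      have hc : Continuous fun s => 4 * π * (‖g s‖ * ‖u s‖) := by fun_prop
      have hI : IntegrableOn (fun s => 4 * π * (‖g s‖ * ‖u s‖)) (Set.Icc s t) :=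
        hc.continuousOn.integrableOn_Icc
      have h1 : ‖u t‖ ^ 2 - ‖u s‖ ^ 2 ≤ ∫ y in s..t, 4 * π * (‖g y‖ * ‖u y‖) := by
        refine intervalIntegral.sub_le_integral_of_hasDeriv_right_of_le (g := fun x => ‖u x‖ ^ 2)
          (g' := fun x => 2 * inner ℝ (u x) (deriv u x)) hs
          (by fun_prop) (fun x _ => ((hu x).hasDerivAt.norm_sq).hasDerivWithinAt) hI ?_
        intro x _
        simp only [hder, inner_smul_right, inner_sub_right, real_inner_self_eq_norm_sq]
        have h3 := real_inner_le_norm (u x) (g x)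
        have h4 : 0 ≤ G x * ‖u x‖ ^ 2 := mul_nonneg (hG x) (by positivity)
        have := Real.pi_pos
        nlinarith
      refine (ENNReal.ofReal_le_ofReal h1).trans ?_
      rw [intervalIntegral.integral_of_le hs, ofReal_integral_eq_lintegral_ofReal
        (hI.mono_set Set.Ioc_subset_Icc_self)
        (Filter.Eventually.of_forall fun y => by have := Real.pi_pos; positivity)]
      exact setLIntegral_le_lintegral _ _
    have hl : Filter.Tendsto (fun s => ENNReal.ofReal (‖u t‖ ^ 2 - ‖u s‖ ^ 2)) Filter.atBot
        (nhds (ENNReal.ofReal (‖u t‖ ^ 2))) := by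
      apply ENNReal.tendsto_ofReal
      have := ((hlim.norm.pow 2).const_sub (‖u t‖ ^ 2))
      simpa using this
    exact le_of_tendsto hl ((Filter.eventually_le_atBot t).mono step)
  set K := ENNReal.ofReal (4 * π) * eLpNorm g 2 volume * eLpNorm u 2 volume with hK
  have hold : (∫⁻ s, ENNReal.ofReal (4 * π * (‖g s‖ * ‖u s‖))) ≤ K := by
    have h0 : (0:ℝ) ≤ 4 * π := by have := Real.pi_pos; positivity
    have h5 : ∀ s, ENNReal.ofReal (4 * π * (‖g s‖ * ‖u s‖)) = ENNReal.ofReal (4 * π) * ‖(g • u) s‖ₑ := by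
      intro s
      rw [ENNReal.ofReal_mul h0, ← norm_mul, ofReal_norm]; rfl
    simp_rw [h5]
    rw [lintegral_const_mul' _ _ ENNReal.ofReal_ne_top, ← eLpNorm_one_eq_lintegral_enorm, hK, mul_assoc]
    gcongr
    exact eLpNorm_smul_le_mul_eLpNorm hcu.aestronglyMeasurable hg.aestronglyMeasurable
  have h6 : eLpNorm u ⊤ volume ≤ K ^ (1 / 2 : ℝ) := by
    rw [eLpNorm_exponent_top]
    refine essSup_le_of_ae_le _ (Filter.Eventually.of_forall fun t => ?_)
    have h7 := (key t).trans hold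
    rw [ENNReal.ofReal_pow (norm_nonneg _), ofReal_norm] at h7
    change ‖u t‖ₑ ≤ _
    rw [one_div, ENNReal.le_rpow_inv_iff (by norm_num)]
    exact_mod_cast h7
  calc _ ≤ (K ^ (1 / 2 : ℝ)) ^ 2 := by gcongr
    _ = K := by
      rw [← ENNReal.rpow_natCast, ← ENNReal.rpow_mul]; norm_num

/-- pointwise (sup-norm) estimate
`‖u‖²_{L^∞} ≤ C₁ ‖P̃u‖_{L²} ‖u‖_{L²}`, uniform in the parameters. -/
theorem statement8
    (n : ℕ) (hn : 1 ≤ n) (σ : ℝ) (hσ0 : 0 < σ) (hσ1 : σ < 1)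
    (w : E n → ℝ) (hw : ContDiff ℝ (⊤ : ℕ∞) w)
    (hw01 : ∀ x, 0 ≤ w x ∧ w x ≤ 1)
    (hwout : ∀ x : E n, 2 ≤ ‖x‖ → w x = 1)
    (hwin : ∀ x : E n, ‖x‖ ≤ 1 → w x = 0)
    (a : ℝ × E n × E n → ℝ) (ha : ContDiff ℝ (⊤ : ℕ∞) a)
    (haB : ∀ k : ℕ, ∃ C : ℝ, ∀ p, ‖iteratedFDeriv ℝ k a p‖ ≤ C)
    (a₀ : ℝ) (ha₀ : 0 < a₀) (haLB : ∀ p, a₀ ≤ a p)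
    :
    ∃ C₁ : ℝ, 0 < C₁ ∧ ∀ u : SchwartzMap ℝ ℂ, ∀ x₁ x₂ ξ₁ ξ₂ : E n,
      eLpNorm (⇑u) ⊤ volume ^ 2
        ≤ ENNReal.ofReal C₁ *
            eLpNorm (Ptilde σ w a x₁ x₂ ξ₁ ξ₂ ⇑u) 2 volume * eLpNorm (⇑u) 2 volume := by
  refine ⟨4 * π, by have := Real.pi_pos; positivity, fun u x₁ x₂ ξ₁ ξ₂ => ?_⟩
  have hF : Continuous (Fsym σ w) := by
    have := hw.continuous
    unfold Fsym
    refine ((continuous_norm.rpow_const fun x => Or.inr (by positivity)).mul this).add ?_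
    fun_prop
  have hFn : ∀ x, 0 ≤ Fsym σ w x := fun x => by
    unfold Fsym
    have h1 := (hw01 x).1
    have h2 : 0 ≤ 1 - w x := by linarith [(hw01 x).2]
    positivity
  have hac := ha.continuous
  have hdc : Continuous (deriv u) := (u.smooth 1).continuous_deriv le_rfl
  have hlim : Filter.Tendsto u Filter.atBot (nhds 0) :=
    u.tendsto_cocompact.mono_left atBot_le_cocompact
  refine aux_ineq u _ (fun t => a (t, ξ₂, ξ₁ + t • ξ₂) * Fsym σ w (x₂ - t • x₁)) u.differentiable ?_
    (fun t => mul_nonneg (ha₀.le.trans (haLB _)) (hFn _)) (fun t => rfl) hlim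
  have huc := u.continuous
  unfold Ptilde
  fun_prop
end
end

section
/- There exists a constant C > 0 such that for every j ∈ {1,…,n}, all u ∈ 𝒮(ℝ_t) and all parameters (x₁,x₂,ξ₁,ξ₂) ∈ ℝ^{4n}, one has ‖⟨x₁⟩^{2σ/(2σ+1)} u‖²_{L²(ℝ_t)} + ‖ |x_{2,j} − t x_{1,j}|^{2σ} u‖²_{L²(ℝ_t)} ≤ C ‖P̃u‖²_{L²(ℝ_t)} + C ‖u‖²_{L²(ℝ_t)}, where x_{1,j} and x_{2,j} denote the j-th components of x₁ and x₂. -/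
open MeasureTheory
open scoped ENNReal Real

noncomputable section

variable {n : ℕ}

lemma psi_bound (σ a₀ : ℝ) (h0 : 0 < σ) (h1 : σ < 1) (ha : 0 < a₀) (τ : ℝ) :
    min (1/2) (π * a₀) * (1 + |τ| ^ (2*σ)) ^ 2 ≤
      4 * π * a₀ * ((8 + 1/a₀) * (π + Real.arctan τ) + (1 + τ^2) ^ σ) * |τ| ^ (2*σ)
      + ((8 + 1/a₀) * (1 / (1 + τ^2)) + 2 * τ * σ * (1 + τ^2) ^ (σ - 1)) := by
  have hx0 : 0 ≤ |τ| ^ (2*σ) := by positivity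
  have hpi := Real.pi_gt_three
  have hat : 1 ≤ π + Real.arctan τ := by
    have := Real.neg_pi_div_two_lt_arctan τ
    linarith
  have hM : 0 < 8 + 1/a₀ := by positivity
  have haM : a₀ * (8 + 1/a₀) = 8 * a₀ + 1 := by field_simp
  have hsq : |τ| ^ (2*σ) = (τ^2) ^ σ := by
    rw [← sq_abs, ← Real.rpow_natCast_mul (abs_nonneg _)]; norm_num
  have hge : |τ| ^ (2*σ) ≤ (1 + τ^2) ^ σ := by
    rw [hsq]; exact Real.rpow_le_rpow (by positivity) (by linarith) h0.le
  have hΨ : (8 + 1/a₀) + |τ| ^ (2*σ) ≤ (8 + 1/a₀) * (π + Real.arctan τ) + (1 + τ^2) ^ σ := by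
    nlinarith
  set Ψ := (8 + 1/a₀) * (π + Real.arctan τ) + (1 + τ^2) ^ σ
  have habs : |2 * τ * σ * (1 + τ^2) ^ (σ - 1)| = σ * (2 * (|τ| * (1 + τ^2) ^ (σ - 1))) := by
    have : 0 < (1 + τ^2) ^ (σ - 1) := by positivity
    rw [abs_mul, abs_mul, abs_mul, abs_of_pos this, abs_of_pos h0]; norm_num; ring
  have hneg := neg_abs_le (2 * τ * σ * (1 + τ^2) ^ (σ - 1))
  rw [habs] at hneg
  have hp0 : 0 ≤ |τ| * (1 + τ^2) ^ (σ - 1) := by positivity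
  rcases le_total |τ| 1 with h | h
  · have hx1 : |τ| ^ (2*σ) ≤ 1 := Real.rpow_le_one (abs_nonneg _) h (by linarith)
    have hp1 : |τ| * (1 + τ^2) ^ (σ - 1) ≤ 1 := by
      have : (1 + τ^2) ^ (σ - 1) ≤ 1 :=
        Real.rpow_le_one_of_one_le_of_nonpos (by nlinarith [sq_nonneg τ]) (by linarith)
      have h2 : 0 < (1 + τ^2) ^ (σ - 1) := by positivity
      nlinarith [abs_nonneg τ]
    have ht : τ^2 ≤ 1 := by rw [← sq_abs]; nlinarith [abs_nonneg τ]
    have hd : 1/2 ≤ 1 / (1 + τ^2) := by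
      apply one_div_le_one_div_of_le <;> nlinarith [sq_nonneg τ]
    have hΨ0 : 0 ≤ Ψ := by linarith
    have : 0 ≤ 4 * π * a₀ * Ψ * |τ| ^ (2*σ) := by positivity
    have h4 : 4 ≤ (8 + 1/a₀) * (1 / (1 + τ^2)) := by
      have : 0 < 1/a₀ := by positivity
      nlinarith
    have h5 : min (1/2) (π * a₀) * (1 + |τ| ^ (2*σ)) ^ 2 ≤ 1/2 * (1 + 1)^2 := by
      gcongr
      exact min_le_left _ _
    nlinarith
  · have hx1 : 1 ≤ |τ| ^ (2*σ) := Real.one_le_rpow h (by linarith)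
    have hp1 : |τ| * (1 + τ^2) ^ (σ - 1) ≤ |τ| ^ (2*σ) := by
      have hτ : 0 < |τ| := by linarith
      have h2 : (1 + τ^2) ^ (σ - 1) ≤ (τ^2) ^ (σ - 1) :=
        Real.rpow_le_rpow_of_nonpos (by rw [← sq_abs]; positivity) (by linarith) (by linarith)
      have h3 : |τ|^2 * (τ^2) ^ (σ - 1) = |τ| ^ (2*σ) := by
        rw [hsq, sq_abs]
        have : 0 < τ^2 := by rw [← sq_abs]; positivity
        rw [Real.rpow_sub_one this.ne', mul_div_cancel₀ _ this.ne']
      have h4 : 0 < (1 + τ^2) ^ (σ - 1) := by positivity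
      calc _ ≤ |τ|^2 * (τ^2) ^ (σ - 1) := by
            gcongr; nlinarith
        _ = _ := h3
    have h5 : min (1/2) (π * a₀) * (1 + |τ| ^ (2*σ)) ^ 2 ≤ (π * a₀) * (|τ| ^ (2*σ) + |τ| ^ (2*σ))^2 := by
      gcongr
      exact min_le_right _ _
    have h6 : 0 ≤ (8 + 1/a₀) * (1 / (1 + τ^2)) := by positivity
    have h7 : 4 * π * a₀ * ((8 + 1/a₀) + |τ| ^ (2*σ)) * |τ| ^ (2*σ) ≤ 4 * π * a₀ * Ψ * |τ| ^ (2*σ) := by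
      gcongr
    set x := |τ| ^ (2*σ)
    have h8 : 4 * π * a₀ * ((8 + 1/a₀) + x) * x = 4 * π * (8*a₀+1) * x + 4 * (π*a₀) * x^2 := by
      rw [← haM]; ring
    have h9 : 2 * x ≤ 4 * π * (8*a₀+1) * x := by
      gcongr
      nlinarith
    nlinarith

/-- weights -/
lemma weight (σ a₀ : ℝ) (h0 : 0 < σ) (h1 : σ < 1) (ha : 0 < a₀) :
    ∃ c K : ℝ, 0 < c ∧ 0 < K ∧ ∀ α β : ℝ, ∃ φ φ' : ℝ → ℝ, ∀ t,
      HasDerivAt φ (φ' t) t ∧ 0 ≤ φ t ∧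
      φ t ≤ K * (|α| ^ (2*σ/(2*σ+1)) + |β - t*α| ^ (2*σ)) ∧
      c * (|α| ^ (2*σ/(2*σ+1)) + |β - t*α| ^ (2*σ))^2 ≤
        4 * π * a₀ * φ t * |β - t*α| ^ (2*σ) - φ' t := by
  have hpi := Real.pi_gt_three
  refine ⟨min (1/2) (π * a₀), (8 + 1/a₀) * (2*π) + 1, by positivity, by positivity, ?_⟩
  intro α β
  by_cases hα : α = 0
  · subst hα
    refine ⟨fun _ => |β| ^ (2*σ), fun _ => 0, fun t => ⟨hasDerivAt_const _ _, by positivity, ?_, ?_⟩⟩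
    · have : 0 ≤ |β| ^ (2*σ) := by positivity
      have : 0 < 1/a₀ := by positivity
      rw [abs_zero, Real.zero_rpow (by positivity)]
      simp only [mul_zero, sub_zero, zero_add]
      nlinarith [show 0 ≤ (8 + 1/a₀) * (2*π) by positivity]
    · rw [abs_zero, Real.zero_rpow (by positivity)]
      simp only [mul_zero, sub_zero, zero_add]
      have : min (1/2) (π * a₀) * (|β| ^ (2*σ))^2 ≤ π * a₀ * (|β| ^ (2*σ))^2 := by
        gcongr
        exact min_le_right _ _
      nlinarith [show 0 ≤ π * a₀ * (|β| ^ (2*σ))^2 by positivity]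
  have hα' : 0 < |α| := abs_pos.mpr hα
  obtain ⟨μ, hμ⟩ : ∃ μ, μ = |α| ^ (1/(2*σ+1)) := ⟨_, rfl⟩
  obtain ⟨l, hl⟩ : ∃ l, l = |α| ^ (2*σ/(2*σ+1)) := ⟨_, rfl⟩
  have hμ0 : 0 < μ := by rw [hμ]; positivity
  have hl0 : 0 < l := by rw [hl]; positivity
  have e1 : |α| = l * μ := by
    rw [hl, hμ, ← Real.rpow_add hα', ← add_div, div_self (by positivity), Real.rpow_one]
  have e2 : μ ^ (2*σ) = l := by
    rw [hl, hμ, ← Real.rpow_mul hα'.le]; congr 1; ring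
  obtain ⟨ε, hε, hε1⟩ : ∃ ε : ℝ, |ε| = 1 ∧ ε * α = |α| := by
    rcases le_total 0 α with h | h
    · exact ⟨1, by simp, by simp [abs_of_nonneg h]⟩
    · exact ⟨-1, by simp, by simp [abs_of_nonpos h]⟩
  rw [← hl]
  let τ : ℝ → ℝ := fun t => ε * (β - t*α) / μ
  have hτ : ∀ t, HasDerivAt τ (-l) t := by
    intro t
    have : HasDerivAt τ (ε * (-(1*α)) / μ) t :=
      ((((hasDerivAt_id t).mul_const α).const_sub β).const_mul ε).div_const μ
    convert this using 1
    rw [one_mul, mul_neg, hε1, e1]; field_simp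
  have hs : ∀ t, |β - t*α| ^ (2*σ) = l * |τ t| ^ (2*σ) := by
    intro t
    rw [← e2, ← Real.mul_rpow hμ0.le (abs_nonneg _)]
    congr 1
    simp only [τ, abs_div, abs_mul, hε, abs_of_pos hμ0]; field_simp
  let M := 8 + 1/a₀
  have hM : 0 < M := by positivity
  refine ⟨fun t => l * (M * (π + Real.arctan (τ t)) + (1 + (τ t)^2) ^ σ),
    fun t => - l^2 * (M * (1 / (1 + (τ t)^2)) + 2 * τ t * σ * (1 + (τ t)^2) ^ (σ - 1)), fun t => ⟨?_, ?_, ?_, ?_⟩⟩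
  · have d1 := (((hτ t).arctan).const_add π).const_mul M
    have d0 : HasDerivAt (fun t => 1 + (τ t)^2) (2 * τ t * (-l)) t := by
      exact (((hτ t).pow 2).const_add 1).congr_deriv (by norm_num)
    have d2 := d0.rpow_const (p := σ) (Or.inl (by positivity))
    exact ((d1.add d2).const_mul l).congr_deriv (by ring)
  · have := Real.neg_pi_div_two_lt_arctan (τ t)
    have : 0 < π + Real.arctan (τ t) := by linarith
    positivity
  · rw [hs]
    have := Real.arctan_lt_pi_div_two (τ t)
    have h2 : (1 + (τ t)^2) ^ σ ≤ 1 + |τ t| ^ (2*σ) := by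
      have := Real.rpow_add_le_add_rpow (a := 1) (b := (τ t)^2) (p := σ) (by positivity) (by positivity) h0.le h1.le
      rw [Real.one_rpow] at this
      convert this using 2
      rw [← sq_abs, ← Real.rpow_natCast_mul (abs_nonneg _)]; norm_num
    have h3 : 0 ≤ |τ t| ^ (2*σ) := by positivity
    have h4 : M * (π + Real.arctan (τ t)) ≤ M * (2*π) := by gcongr; linarith
    have h5 : 0 ≤ M * (2*π) * |τ t| ^ (2*σ) := by positivity
    calc l * (M * (π + Real.arctan (τ t)) + (1 + (τ t)^2) ^ σ)
        ≤ l * ((M * (2*π) + 1) * (1 + |τ t| ^ (2*σ))) :=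
          mul_le_mul_of_nonneg_left (by linarith) hl0.le
      _ = _ := by ring
  · rw [hs]
    have := mul_le_mul_of_nonneg_left (psi_bound σ a₀ h0 h1 ha (τ t)) (sq_nonneg l)
    simp only [M]
    linarith

lemma young (c p x y : ℝ) (hc : 0 < c) : p * x * y ≤ c/4 * x^2 + p^2/c * y^2 := by
  have h : 0 ≤ (c/2 * x - p * y)^2 / c := by positivity
  have e : (c/2 * x - p * y)^2 / c = c/4 * x^2 + p^2/c * y^2 - p * x * y := by
    field_simp; ring
  linarith

lemma core (σ a₀ : ℝ) (h0 : 0 < σ) (h1 : σ < 1) (ha : 0 < a₀) :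
    ∃ C : ℝ, 0 < C ∧ ∀ α β : ℝ, ∀ A : ℝ → ℝ, Continuous A →
      (∀ t, a₀ * (|β - t*α| ^ (2*σ) - 4) ≤ A t) → ∀ u : SchwartzMap ℝ ℂ,
      ∫⁻ t, ENNReal.ofReal ((|α| ^ (2*σ/(2*σ+1)) + |β - t*α| ^ (2*σ))^2 * ‖u t‖^2) ≤
        ENNReal.ofReal C * ∫⁻ t, ENNReal.ofReal
          (‖u t‖^2 + ‖(((2*π)⁻¹ : ℝ) : ℂ) * deriv u t + (A t : ℂ) * u t‖^2) := by
  obtain ⟨c, K, hc, hK, hW⟩ := weight σ a₀ h0 h1 ha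
  let C' := ((16*π*a₀*K)^2 + (4*π*K)^2)/c
  have hC' : 0 < C' := by positivity
  refine ⟨2/c*C', by positivity, ?_⟩
  intro α β A hA hAs u
  obtain ⟨φ, φ', hφ⟩ := hW α β
  let W : ℝ → ℝ := fun t => |α| ^ (2*σ/(2*σ+1)) + |β - t*α| ^ (2*σ)
  have hWc : Continuous W := by
    have : Continuous fun t : ℝ => |β - t*α| ^ (2*σ) :=
      Continuous.rpow_const (by fun_prop) (fun _ => Or.inr (by positivity))
    exact continuous_const.add this
  have hW0 : ∀ t, 0 ≤ W t := fun t => by positivity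
  let f : ℝ → ℂ := fun t => (((2*π)⁻¹ : ℝ) : ℂ) * deriv u t + (A t : ℂ) * u t
  have hu' : Continuous (deriv u) := (u.smooth 1).continuous_deriv le_rfl
  have huc : Continuous u := u.continuous
  have hf : Continuous f := by
    have : Continuous fun t => (A t : ℂ) := Complex.continuous_ofReal.comp hA
    exact (continuous_const.mul hu').add (this.mul huc)
  have hd : ∀ t, HasDerivAt (fun t => φ t * ‖u t‖^2)
      (φ' t * ‖u t‖^2 + φ t * (2 * inner ℝ (u t) (deriv u t))) t := fun t =>
    (hφ t).1.mul (u.differentiableAt.hasDerivAt.norm_sq)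
  have hinner : ∀ t, inner ℝ (u t) (deriv u t) ≤ 2*π*(‖u t‖ * ‖f t‖) - 2*π*A t*‖u t‖^2 := by
    intro t
    have e : deriv u t = (2*π) • f t - (2*π*A t) • u t := by
      simp only [f, Complex.real_smul]
      push_cast
      have : (π:ℂ) ≠ 0 := by exact_mod_cast Real.pi_ne_zero
      field_simp; ring
    rw [e, inner_sub_right, inner_smul_right, inner_smul_right, real_inner_self_eq_norm_sq]
    have := real_inner_le_norm (u t) (f t)
    have h2 : 2*π * inner ℝ (u t) (f t) ≤ 2*π*(‖u t‖ * ‖f t‖) := by gcongr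
    simpa using h2
  have hpt : ∀ t, φ' t * ‖u t‖^2 + φ t * (2 * inner ℝ (u t) (deriv u t)) ≤
      C' * (‖u t‖^2 + ‖f t‖^2) - c/2 * (W t^2 * ‖u t‖^2) := by
    intro t
    obtain ⟨-, p0, pK, pc⟩ := hφ t
    change φ t ≤ K * W t at pK
    change c * (W t)^2 ≤ _ at pc
    have i1 := mul_le_mul_of_nonneg_left (hinner t) p0
    have i2 := mul_le_mul_of_nonneg_right pc (sq_nonneg ‖u t‖)
    have i3 : φ t * (a₀ * (|β - t*α| ^ (2*σ) - 4)) * (4*π*‖u t‖^2) ≤ φ t * A t * (4*π*‖u t‖^2) := by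
      gcongr
      exact hAs t
    have i4 : φ t * (16*π*a₀*‖u t‖^2) ≤ K * W t * (16*π*a₀*‖u t‖^2) := by gcongr
    have i5 : φ t * (4*π*(‖u t‖*‖f t‖)) ≤ K * W t * (4*π*(‖u t‖*‖f t‖)) := by gcongr
    have y1 := young c (16*π*a₀*K) (W t * ‖u t‖) ‖u t‖ hc
    have y2 := young c (4*π*K) (W t * ‖u t‖) ‖f t‖ hc
    have z1 : 0 ≤ (16*π*a₀*K)^2/c * ‖f t‖^2 := by positivity
    have z2 : 0 ≤ (4*π*K)^2/c * ‖u t‖^2 := by positivity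
    have e : C' * (‖u t‖^2 + ‖f t‖^2) = (16*π*a₀*K)^2/c * ‖u t‖^2 + (4*π*K)^2/c * ‖u t‖^2
      + (16*π*a₀*K)^2/c * ‖f t‖^2 + (4*π*K)^2/c * ‖f t‖^2 := by simp only [C']; ring
    rw [e]
    linarith
  -- decay
  have hdecay : Filter.Tendsto (fun N : ℕ => φ (-(N:ℝ)) * ‖u (-(N:ℝ))‖^2) Filter.atTop (nhds 0) := by
    obtain ⟨B0, hB0, hb0⟩ := u.decay 0 0
    obtain ⟨B2, hB2, hb2⟩ := u.decay 2 0
    let l := |α| ^ (2*σ/(2*σ+1))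
    have hl : 0 ≤ l := by positivity
    let D := K * ((l + 2*(1+|β|)^2) * B0 + 2*α^2 * B2)
    have hbd : ∀ t, φ t * ‖u t‖^2 ≤ D * ‖u t‖ := by
      intro t
      have q0 := hb0 t
      have q2 := hb2 t
      simp only [norm_iteratedFDeriv_zero, pow_zero, one_mul, Real.norm_eq_abs, sq_abs] at q0 q2
      have q3 : |β - t*α| ^ (2*σ) ≤ 2*(1+|β|)^2 + 2*α^2*t^2 := by
        calc |β - t*α| ^ (2*σ) ≤ (1 + |β - t*α|) ^ (2*σ) :=
              Real.rpow_le_rpow (abs_nonneg _) (by linarith) (by linarith)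
          _ ≤ (1 + |β - t*α|) ^ (2:ℝ) :=
              Real.rpow_le_rpow_of_exponent_le (by linarith [abs_nonneg (β - t*α)]) (by linarith)
          _ = (1 + |β - t*α|) ^ 2 := by norm_num
          _ ≤ ((1 + |β|) + |t*α|)^2 := by
              have := abs_sub β (t*α)
              exact pow_le_pow_left₀ (by positivity) (by linarith) 2
          _ ≤ 2*(1+|β|)^2 + 2*|t*α|^2 := by nlinarith [sq_nonneg ((1+|β|) - |t*α|)]
          _ = _ := by rw [sq_abs]; ring
      have q4 : φ t ≤ K * ((l + 2*(1+|β|)^2) + 2*α^2*t^2) := by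
        refine (hφ t).2.2.1.trans ?_
        refine mul_le_mul_of_nonneg_left ?_ hK.le
        simp only [l]; linarith
      have q5 : φ t * ‖u t‖ ≤ D := by
        calc _ ≤ K * ((l + 2*(1+|β|)^2) + 2*α^2*t^2) * ‖u t‖ := by gcongr
          _ = K * ((l + 2*(1+|β|)^2) * ‖u t‖ + 2*α^2*(t^2 * ‖u t‖)) := by ring
          _ ≤ D := by simp only [D]; gcongr
      rw [pow_two, ← mul_assoc]; gcongr
    have hz : Filter.Tendsto (fun N : ℕ => D * ‖u (-(N:ℝ))‖) Filter.atTop (nhds 0) := by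
      have t1 : Filter.Tendsto (fun N : ℕ => -(N:ℝ)) Filter.atTop (Filter.cocompact ℝ) :=
        (Filter.tendsto_neg_atTop_atBot.comp tendsto_natCast_atTop_atTop).mono_right atBot_le_cocompact
      have := ((u.tendsto_cocompact.comp t1).norm).const_mul D
      simpa using this
    exact squeeze_zero (fun N => mul_nonneg (hφ _).2.1 (by positivity)) (fun N => hbd _) hz
  -- integrate
  have hWu : Continuous fun t => W t^2 * ‖u t‖^2 := by fun_prop
  have huf : Continuous fun t => ‖u t‖^2 + ‖f t‖^2 := by fun_prop
  let I := ∫⁻ t, ENNReal.ofReal (‖u t‖^2 + ‖f t‖^2)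
  change ∫⁻ t, ENNReal.ofReal (W t^2 * ‖u t‖^2) ≤ ENNReal.ofReal (2/c*C') * I
  have key : ∀ N : ℕ, ∫⁻ t in Set.Ioc (-(N:ℝ)) N, ENNReal.ofReal (W t^2 * ‖u t‖^2) ≤
      ENNReal.ofReal (2/c*C') * I + ENNReal.ofReal (2/c * (φ (-(N:ℝ)) * ‖u (-(N:ℝ))‖^2)) := by
    intro N
    have hN : -(N:ℝ) ≤ N := by linarith [Nat.cast_nonneg (α := ℝ) N]
    have hcont : Continuous fun t => φ t * ‖u t‖^2 :=
      continuous_iff_continuousAt.2 fun t => (hd t).continuousAt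
    have hh : Continuous fun t => C' * (‖u t‖^2 + ‖f t‖^2) - c/2 * (W t^2 * ‖u t‖^2) := by fun_prop
    have hi := intervalIntegral.sub_le_integral_of_hasDeriv_right_of_le hN hcont.continuousOn
      (fun t _ => (hd t).hasDerivWithinAt) (hh.integrableOn_Icc) (fun t _ => hpt t)
    rw [intervalIntegral.integral_sub ((huf.const_mul C').intervalIntegrable _ _)
      ((hWu.const_mul (c/2)).intervalIntegrable _ _), intervalIntegral.integral_const_mul,
      intervalIntegral.integral_const_mul] at hi
    have hg : 0 ≤ φ N * ‖u N‖^2 := mul_nonneg (hφ _).2.1 (by positivity)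
    have hi2 : ∫ t in (-(N:ℝ))..N, W t^2 * ‖u t‖^2 ≤ 2/c*C' * (∫ t in (-(N:ℝ))..N, (‖u t‖^2 + ‖f t‖^2))
        + 2/c * (φ (-(N:ℝ)) * ‖u (-(N:ℝ))‖^2) := by
      have : c/2 * ∫ t in (-(N:ℝ))..N, W t^2 * ‖u t‖^2 ≤ C' * (∫ t in (-(N:ℝ))..N, (‖u t‖^2 + ‖f t‖^2))
        + (φ (-(N:ℝ)) * ‖u (-(N:ℝ))‖^2) := by linarith
      have h3 := mul_le_mul_of_nonneg_left this (show 0 ≤ 2/c by positivity)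
      have e : 2/c * (c/2 * ∫ t in (-(N:ℝ))..N, W t^2 * ‖u t‖^2) = ∫ t in (-(N:ℝ))..N, W t^2 * ‖u t‖^2 := by
        field_simp
      rw [e] at h3
      linarith
    rw [intervalIntegral.integral_of_le hN, intervalIntegral.integral_of_le hN] at hi2
    have g1 := ofReal_integral_eq_lintegral_ofReal (μ := volume.restrict (Set.Ioc (-(N:ℝ)) N))
      (hWu.integrableOn_Ioc) (Filter.Eventually.of_forall fun t => by positivity)
    have g2 := ofReal_integral_eq_lintegral_ofReal (μ := volume.restrict (Set.Ioc (-(N:ℝ)) N))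
      (huf.integrableOn_Ioc) (Filter.Eventually.of_forall fun t => by positivity)
    rw [← g1]
    refine (ENNReal.ofReal_le_ofReal hi2).trans ?_
    refine ENNReal.ofReal_add_le.trans ?_
    rw [ENNReal.ofReal_mul (by positivity), g2]
    gcongr
    exact lintegral_mono' Measure.restrict_le_self le_rfl
  have hcov := (aecover_Ioc (μ := (volume : Measure ℝ)) (l := Filter.atTop) (a := fun N : ℕ => -(N:ℝ))
    (b := fun N : ℕ => (N:ℝ)) (Filter.tendsto_neg_atTop_atBot.comp tendsto_natCast_atTop_atTop)
    tendsto_natCast_atTop_atTop).lintegral_tendsto_of_countably_generated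
      (f := fun t => ENNReal.ofReal (W t^2 * ‖u t‖^2)) (by fun_prop)
  have hr : Filter.Tendsto (fun N : ℕ => ENNReal.ofReal (2/c*C') * I
      + ENNReal.ofReal (2/c * (φ (-(N:ℝ)) * ‖u (-(N:ℝ))‖^2))) Filter.atTop
      (nhds (ENNReal.ofReal (2/c*C') * I + 0)) := by
    refine tendsto_const_nhds.add ?_
    have := ENNReal.tendsto_ofReal (hdecay.const_mul (2/c))
    simpa using this
  simpa using le_of_tendsto_of_tendsto' hcov hr key

lemma sq_eLp (g : ℝ → ℂ) : eLpNorm g 2 volume ^ 2 = ∫⁻ t, ENNReal.ofReal (‖g t‖^2) := by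
  have := eLpNorm_nnreal_pow_eq_lintegral (μ := (volume : Measure ℝ)) (f := g) (p := 2) (by norm_num)
  have e : ((2 : NNReal) : ℝ) = ((2 : ℕ) : ℝ) := by norm_num
  rw [e] at this
  simp only [ENNReal.rpow_natCast] at this
  have e2 : ((2 : NNReal) : ℝ≥0∞) = 2 := by norm_num
  rw [e2] at this
  rw [this]
  congr 1
  ext t
  rw [ENNReal.ofReal_pow (norm_nonneg _), ofReal_norm]

lemma sum_rpow {ι : Type*} (s : Finset ι) (g : ι → ℝ) (hg : ∀ i, 0 ≤ g i) (p : ℝ) (h0 : 0 < p) (h1 : p ≤ 1) :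
    (1 + ∑ i ∈ s, g i) ^ p ≤ 1 + ∑ i ∈ s, g i ^ p := by
  classical
  induction s using Finset.induction_on with
  | empty => simp
  | insert a s ha ih =>
    rw [Finset.sum_insert ha, Finset.sum_insert ha]
    have h2 : 0 ≤ ∑ i ∈ s, g i := Finset.sum_nonneg fun i _ => hg i
    have := Real.rpow_add_le_add_rpow (a := g a) (b := 1 + ∑ i ∈ s, g i) (hg a) (by linarith) h0.le h1
    calc _ = (g a + (1 + ∑ i ∈ s, g i)) ^ p := by congr 1; ring
      _ ≤ _ := by linarith

lemma Fsym_lower (σ : ℝ) (hσ0 : 0 < σ) (hσ1 : σ < 1) {n : ℕ} (w : E n → ℝ)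
    (hw01 : ∀ x, 0 ≤ w x ∧ w x ≤ 1) (hwout : ∀ x : E n, 2 ≤ ‖x‖ → w x = 1) (x : E n) (j : Fin n) :
    |x j| ^ (2*σ) - 4 ≤ Fsym σ w x ∧ 0 ≤ Fsym σ w x := by
  have hp : 0 ≤ ‖x‖ ^ (2*σ) := by positivity
  have h0 : 0 ≤ Fsym σ w x := by
    unfold Fsym
    have := hw01 x
    have := mul_nonneg hp this.1
    have := mul_nonneg (sq_nonneg ‖x‖) (sub_nonneg.2 (hw01 x).2)
    linarith
  refine ⟨?_, h0⟩
  have hj : |x j| ^ (2*σ) ≤ ‖x‖ ^ (2*σ) :=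
    Real.rpow_le_rpow (abs_nonneg _) (PiLp.norm_apply_le x j) (by linarith)
  rcases le_total 2 ‖x‖ with h | h
  · rw [Fsym, hwout x h]; simp; linarith
  · have : ‖x‖ ^ (2*σ) ≤ 4 := by
      calc ‖x‖ ^ (2*σ) ≤ (2:ℝ) ^ (2*σ) := Real.rpow_le_rpow (norm_nonneg _) h (by linarith)
        _ ≤ (2:ℝ) ^ (2:ℝ) := Real.rpow_le_rpow_of_exponent_le (by norm_num) (by linarith)
        _ = 4 := by norm_num
    linarith

/-- componentwise weighted estimate, uniform in `j` and the
parameters. -/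
theorem statement10
    (n : ℕ) (hn : 1 ≤ n) (σ : ℝ) (hσ0 : 0 < σ) (hσ1 : σ < 1)
    (w : E n → ℝ) (hw : ContDiff ℝ (⊤ : ℕ∞) w)
    (hw01 : ∀ x, 0 ≤ w x ∧ w x ≤ 1)
    (hwout : ∀ x : E n, 2 ≤ ‖x‖ → w x = 1)
    (hwin : ∀ x : E n, ‖x‖ ≤ 1 → w x = 0)
    (a : ℝ × E n × E n → ℝ) (ha : ContDiff ℝ (⊤ : ℕ∞) a)
    (haB : ∀ k : ℕ, ∃ C : ℝ, ∀ p, ‖iteratedFDeriv ℝ k a p‖ ≤ C)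
    (a₀ : ℝ) (ha₀ : 0 < a₀) (haLB : ∀ p, a₀ ≤ a p)
    :
    ∃ C : ℝ, 0 < C ∧ ∀ j : Fin n, ∀ u : SchwartzMap ℝ ℂ, ∀ x₁ x₂ ξ₁ ξ₂ : E n,
      eLpNorm (fun t : ℝ => (((1 + ‖x₁‖ ^ 2) ^ (σ / (2 * σ + 1)) : ℝ) : ℂ) * u t) 2 volume ^ 2
          + eLpNorm (fun t : ℝ => ((|x₂ j - t * x₁ j| ^ (2 * σ) : ℝ) : ℂ) * u t) 2 volume ^ 2
        ≤ ENNReal.ofReal C * eLpNorm (Ptilde σ w a x₁ x₂ ξ₁ ξ₂ ⇑u) 2 volume ^ 2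
          + ENNReal.ofReal C * eLpNorm (⇑u) 2 volume ^ 2 := by
  obtain ⟨C, hC, hcore⟩ := core σ a₀ hσ0 hσ1 ha₀
  refine ⟨1 + n * C + C, by positivity, ?_⟩
  intro j u x₁ x₂ ξ₁ ξ₂
  let A : ℝ → ℝ := fun t => a (t, ξ₂, ξ₁ + t • ξ₂) * Fsym σ w (x₂ - t • x₁)
  have hac : Continuous a := ha.continuous
  have hwc : Continuous w := hw.continuous
  have hA : Continuous A := by
    have hF : Continuous (Fsym σ w) := by
      have h1 : Continuous fun x : E n => ‖x‖ ^ (2 * σ) :=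
        continuous_norm.rpow_const (fun _ => Or.inr (by positivity))
      exact (h1.mul hwc).add ((continuous_norm.pow 2).mul (continuous_const.sub hwc))
    exact (hac.comp (by fun_prop)).mul (hF.comp (by fun_prop))
  have hAs : ∀ j : Fin n, ∀ t : ℝ, a₀ * (|x₂ j - t * x₁ j| ^ (2*σ) - 4) ≤ A t := by
    intro j t
    obtain ⟨f1, f2⟩ := Fsym_lower σ hσ0 hσ1 w hw01 hwout (x₂ - t • x₁) j
    have e : (x₂ - t • x₁) j = x₂ j - t * x₁ j := by simp
    rw [e] at f1
    calc _ ≤ a₀ * Fsym σ w (x₂ - t • x₁) := by gcongr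
      _ ≤ _ := by
        simp only [A]
        gcongr
        exact haLB _
  have hP : Ptilde σ w a x₁ x₂ ξ₁ ξ₂ ⇑u =
      fun t => (((2*π)⁻¹ : ℝ) : ℂ) * deriv u t + (A t : ℂ) * u t := by
    funext t
    simp only [Ptilde, A]
    congr 1
    push_cast
    have : (π:ℂ) ≠ 0 := by exact_mod_cast Real.pi_ne_zero
    have := Complex.I_ne_zero
    field_simp
  have hj := fun j => hcore (x₁ j) (x₂ j) A hA (hAs j) u
  rw [sq_eLp, sq_eLp, sq_eLp, sq_eLp, hP]
  have huc : Continuous u := u.continuous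
  have hI : ∫⁻ t : ℝ, ENNReal.ofReal (‖u t‖^2 + ‖(((2*π)⁻¹ : ℝ) : ℂ) * deriv u t + (A t : ℂ) * u t‖^2) =
      (∫⁻ t : ℝ, ENNReal.ofReal (‖u t‖^2)) +
      ∫⁻ t : ℝ, ENNReal.ofReal (‖(((2*π)⁻¹ : ℝ) : ℂ) * deriv u t + (A t : ℂ) * u t‖^2) := by
    rw [← lintegral_add_left (f := fun t => ENNReal.ofReal (‖u t‖^2)) (by fun_prop)]
    congr 1
    ext t
    rw [ENNReal.ofReal_add (by positivity) (by positivity)]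
  set U := ∫⁻ t : ℝ, ENNReal.ofReal (‖u t‖^2)
  set V := ∫⁻ t : ℝ, ENNReal.ofReal (‖(((2*π)⁻¹ : ℝ) : ℂ) * deriv u t + (A t : ℂ) * u t‖^2)
  simp only [hI] at hj
  have s2 : ∫⁻ t : ℝ, ENNReal.ofReal (‖((|x₂ j - t * x₁ j| ^ (2 * σ) : ℝ) : ℂ) * u t‖^2) ≤
      ENNReal.ofReal C * (U + V) := by
    refine le_trans (lintegral_mono fun t => ENNReal.ofReal_le_ofReal ?_) (hj j)
    have h1 : 0 ≤ |x₂ j - t * x₁ j| ^ (2 * σ) := by positivity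
    have h2 : 0 ≤ |x₁ j| ^ (2*σ/(2*σ+1)) := by positivity
    rw [norm_mul, Complex.norm_real, Real.norm_of_nonneg h1, mul_pow]
    gcongr
    linarith
  have s1 : ∫⁻ t : ℝ, ENNReal.ofReal (‖(((1 + ‖x₁‖ ^ 2) ^ (σ / (2 * σ + 1)) : ℝ) : ℂ) * u t‖^2) ≤
      U + n * (ENNReal.ofReal C * (U + V)) := by
    have hW : ∀ j : Fin n, Continuous fun t : ℝ =>
        (|x₁ j| ^ (2*σ/(2*σ+1)) + |x₂ j - t * x₁ j| ^ (2*σ))^2 * ‖u t‖^2 := by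
      intro j
      have : Continuous fun t : ℝ => |x₂ j - t * x₁ j| ^ (2*σ) :=
        Continuous.rpow_const (by fun_prop) (fun _ => Or.inr (by positivity))
      fun_prop
    calc _ ≤ ∫⁻ t : ℝ, (ENNReal.ofReal (‖u t‖^2) + ∑ j : Fin n, ENNReal.ofReal
          ((|x₁ j| ^ (2*σ/(2*σ+1)) + |x₂ j - t * x₁ j| ^ (2*σ))^2 * ‖u t‖^2)) := by
          refine lintegral_mono fun t => ?_
          rw [← ENNReal.ofReal_sum_of_nonneg (fun _ _ => by positivity),
            ← ENNReal.ofReal_add (by positivity) (Finset.sum_nonneg fun _ _ => by positivity)]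
          refine ENNReal.ofReal_le_ofReal ?_
          have h1 : 0 ≤ (1 + ‖x₁‖ ^ 2) ^ (σ / (2 * σ + 1)) := by positivity
          rw [norm_mul, Complex.norm_real, Real.norm_of_nonneg h1, mul_pow, ← Finset.sum_mul,
            ← one_add_mul]
          refine mul_le_mul_of_nonneg_right ?_ (sq_nonneg _)
          have e1 : ((1 + ‖x₁‖ ^ 2) ^ (σ / (2 * σ + 1)))^2 =
              (1 + ∑ i, (|x₁ i|)^2) ^ (2 * σ / (2 * σ + 1)) := by
            rw [← Real.rpow_mul_natCast (by positivity), EuclideanSpace.norm_sq_eq]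
            simp only [Real.norm_eq_abs]
            congr 1
            push_cast; ring
          rw [e1]
          refine (sum_rpow Finset.univ (fun i => (|x₁ i|)^2) (fun i => sq_nonneg _) _
            (by positivity) ?_).trans ?_
          · rw [div_le_one (by positivity)]; linarith
          · gcongr with i
            have h3 : 0 ≤ |x₁ i| ^ (2*σ/(2*σ+1)) := by positivity
            have h4 : 0 ≤ |x₂ i - t * x₁ i| ^ (2 * σ) := by positivity
            calc _ = (|x₁ i| ^ (2*σ/(2*σ+1)))^2 := by
                  rw [← Real.rpow_natCast_mul (abs_nonneg _), ← Real.rpow_mul_natCast (abs_nonneg _),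
                    mul_comm]
              _ ≤ _ := by gcongr; linarith
      _ = U + ∑ j : Fin n, ∫⁻ t : ℝ, ENNReal.ofReal
          ((|x₁ j| ^ (2*σ/(2*σ+1)) + |x₂ j - t * x₁ j| ^ (2*σ))^2 * ‖u t‖^2) := by
          rw [lintegral_add_left (by fun_prop), lintegral_finsetSum]
          intro j _
          exact ENNReal.measurable_ofReal.comp (hW j).measurable
      _ ≤ U + ∑ j : Fin n, ENNReal.ofReal C * (U + V) := by
          gcongr with j
          exact hj j
      _ = _ := by simp
  refine (add_le_add s1 s2).trans ?_
  rw [ENNReal.ofReal_add (by positivity) hC.le, ENNReal.ofReal_add (by positivity) (by positivity),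
    ENNReal.ofReal_mul (by positivity), ENNReal.ofReal_one, ENNReal.ofReal_natCast]
  calc _ ≤ (U + n * (ENNReal.ofReal C * (U + V)) + ENNReal.ofReal C * (U + V)) + V := le_self_add
    _ = _ := by ring
end
end
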